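/- Let K₅ ≥ 0 and K₆ > 0, and let a₀, a₂ : [0,∞) → ℝ be continuous functions with |a₀(t)| ≤ K₅ and a₂(t) ≥ K₆ for all t ≥ 0, and suppose moreover ∫₀^∞ a₂(s) ds = +∞. Then there is no differentiable function y : [0,∞) → ℝ satisfying y′(t) = a₀(t) − a₂(t) y(t)² for all t ≥ 0 together with y(0) < −√(K₅/K₆); i.e., any solution of this Riccati equation with such initial data blows up (tends to −∞) in finite time. -/

import Mathlib

open Real Set MeasureTheory

theorem stmt17 (K₅ K₆ : ℝ) (hK₅ : 0 ≤ K₅) (hK₆ : 0 < K₆)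
    (a₀ a₂ : ℝ → ℝ)
    (ha₀c : ContinuousOn a₀ (Ici 0)) (ha₂c : ContinuousOn a₂ (Ici 0))
    (ha₀ : ∀ t, 0 ≤ t → |a₀ t| ≤ K₅) (ha₂ : ∀ t, 0 ≤ t → K₆ ≤ a₂ t)
    (hdiv : ¬ IntegrableOn a₂ (Ici 0))
    (y : ℝ → ℝ)
    (hy : ∀ t, 0 ≤ t → HasDerivAt y (a₀ t - a₂ t * y t ^ 2) t)
    (h0 : y 0 < -Real.sqrt (K₅ / K₆)) : False := by
  have hneg : y 0 < 0 := h0.trans_le (neg_nonpos.2 (Real.sqrt_nonneg _))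
  have hsq : K₅ < K₆ * y 0 ^ 2 := by
    have h : K₅ / K₆ < (-y 0) ^ 2 := (Real.sqrt_lt' (neg_pos.2 hneg)).1 (by linarith)
    rw [div_lt_iff₀ hK₆] at h
    linarith
  have hderiv (t : ℝ) (ht : 0 ≤ t) : a₀ t - a₂ t * y t ^ 2 ≤ K₅ - K₆ * y t ^ 2 :=
    sub_le_sub ((le_abs_self _).trans (ha₀ t ht))
      (mul_le_mul_of_nonneg_right (ha₂ t ht) (sq_nonneg _))
  have hle (t : ℝ) (ht : 0 ≤ t) : y t ≤ y 0 := by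
    refine image_le_of_deriv_right_lt_deriv_boundary (B := fun _ => y 0) (B' := fun _ => 0)
      (fun x hx => (hy x hx.1).continuousAt.continuousWithinAt)
      (fun x hx => (hy x hx.1).hasDerivWithinAt) le_rfl (fun x => hasDerivAt_const x (y 0))
      (fun x hx hxy => ?_) (right_mem_Icc.2 ht)
    have h := hderiv x hx.1
    rw [hxy] at h ⊢
    linarith
  have hyneg (t : ℝ) (ht : 0 ≤ t) : y t < 0 := (hle t ht).trans_lt hneg
  have hc : 0 < y 0 ^ 2 := sq_pos_of_neg hneg
  obtain ⟨δ, hδ, hδc⟩ : ∃ δ > 0, K₅ = (K₆ - δ) * y 0 ^ 2 :=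
    ⟨K₆ - K₅ / y 0 ^ 2, sub_pos.2 ((div_lt_iff₀ hc).2 hsq), by rw [sub_sub_cancel, div_mul_cancel₀ _ hc.ne']⟩
  have hK : 0 ≤ K₆ - δ := nonneg_of_mul_nonneg_left (hδc ▸ hK₅) hc
  have hinv (t : ℝ) (ht : 0 ≤ t) : HasDerivAt (fun t => (y t)⁻¹ - δ * t)
      (-(a₀ t - a₂ t * y t ^ 2) / y t ^ 2 - δ * 1) t :=
    ((hy t ht).inv (hyneg t ht).ne).sub ((hasDerivAt_id t).const_mul δ)
  have hmono : MonotoneOn (fun t => (y t)⁻¹ - δ * t) (Ici 0) := by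
    refine monotoneOn_of_hasDerivWithinAt_nonneg (convex_Ici 0)
      (fun t ht => (hinv t ht).continuousAt.continuousWithinAt)
      (fun t ht => (hinv t (interior_subset ht)).hasDerivWithinAt) (fun t ht => ?_)
    have ht' : 0 ≤ t := interior_subset ht
    have hyc : y 0 ^ 2 ≤ y t ^ 2 := by nlinarith [hle t ht']
    rw [mul_one, sub_nonneg, le_div_iff₀ (sq_pos_of_neg (hyneg t ht'))]
    linarith [hderiv t ht', mul_le_mul_of_nonneg_left hyc hK]
  have hT : 0 ≤ -(y 0)⁻¹ / δ := div_nonneg (neg_nonneg.2 (inv_lt_zero.2 hneg).le) hδ.le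
  have h := hmono self_mem_Ici hT hT
  have hlt := inv_lt_zero.2 (hyneg _ hT)
  simp only [mul_div_cancel₀ _ hδ.ne', mul_zero] at h
  linarith
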